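/- arXiv:1708.06947 — 2 statements merged into one kernel-verified Lean document; each statement's English description precedes it below -/
import Mathlib

section
/- There exists a proof-labeling scheme for the matching-verification problem (F_m, MV) in the broadcast model with verification complexity O(log Δ): there is a constant C such that, for every connected graph of maximum degree Δ, the scheme uses messages of length at most C·log₂(Δ+2). -/
open scoped Classical

/-- A configuration: a finite connected simple undirected graph together with a
state assignment mapping each node to its local state. -/
structure Config (V : Type) (S : Type) where
  G : SimpleGraph V
  connected : G.Connected
  state : V → S

/-- A (deterministic) verification scheme: a prover assigning bit-string labels,
and a local verifier consisting of a message function (from own state and label,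
one message per incident edge, addressed by the neighbor at its port) and an
output function (from own state, label and the received messages). -/
structure Scheme (V : Type) (S : Type) where
  prover : Config V S → V → List Bool
  msg : V → S → List Bool → V → List Bool
  out : V → S → List Bool → (V → List Bool) → Bool

/-- The neighbors of a vertex, as a finset. -/
noncomputable def nbrsG {V : Type} [Fintype V] (G : SimpleGraph V) (u : V) : Finset V :=
  Finset.univ.filter fun w => G.Adj u w

/-- The degree of a vertex. -/
noncomputable def degOf {V : Type} [Fintype V] (G : SimpleGraph V) (u : V) : ℕ :=
  (nbrsG G u).card

/-- The maximum degree Δ of a graph. -/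
noncomputable def maxDeg {V : Type} [Fintype V] (G : SimpleGraph V) : ℕ :=
  Finset.univ.sup (degOf G)

/-- The arboricity of a graph: the minimum number of acyclic subsets of edges
covering all edges. -/
noncomputable def arboricity {V : Type} (G : SimpleGraph V) : ℕ :=
  sInf {k : ℕ | ∃ f : Fin k → SimpleGraph V,
    (∀ i, f i ≤ G ∧ (f i).IsAcyclic) ∧
    (∀ u w : V, G.Adj u w → ∃ i, (f i).Adj u w)}

/-- The messages received by node `u` from its neighbors (the default `[]` for
non-neighbors). -/
noncomputable def received {V S : Type} [Fintype V] (Sch : Scheme V S) (C : Config V S)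
    (ℓ : V → List Bool) (u : V) : V → List Bool :=
  fun w => if C.G.Adj u w then Sch.msg w (C.state w) (ℓ w) u else []

/-- All local verifiers output `true`. -/
def Accepts {V S : Type} [Fintype V] (Sch : Scheme V S) (C : Config V S)
    (ℓ : V → List Bool) : Prop :=
  ∀ u : V, Sch.out u (C.state u) (ℓ u) (received Sch C ℓ u) = true

/-- The MCAST(r) restriction: every node sends at most `r` distinct messages. -/
def Mcast {V S : Type} [Fintype V] (F : Set (Config V S)) (r : ℕ) (Sch : Scheme V S) : Prop :=
  ∀ C ∈ F, ∀ (ℓ : V → List Bool) (u : V),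
    ((nbrsG C.G u).image fun w => Sch.msg u (C.state u) (ℓ u) w).card ≤ r

/-- `Sch` is a proof-labeling scheme for `(F, P)` in the MCAST(r) model. -/
def IsPLS {V S : Type} [Fintype V] (F : Set (Config V S)) (P : Config V S → Prop)
    (r : ℕ) (Sch : Scheme V S) : Prop :=
  Mcast F r Sch ∧
  (∀ C ∈ F, P C → Accepts Sch C (Sch.prover C)) ∧
  (∀ C ∈ F, ¬ P C → ∀ ℓ : V → List Bool, ¬ Accepts Sch C ℓ)

/-- The verification complexity of `Sch` is at most `κ`: on every configuration
in the family satisfying the predicate, with the prover's labels, all messages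
have length at most `κ`. -/
def VCBound {V S : Type} [Fintype V] (F : Set (Config V S)) (P : Config V S → Prop)
    (Sch : Scheme V S) (κ : ℕ) : Prop :=
  ∀ C ∈ F, P C → ∀ u w : V, C.G.Adj u w →
    (Sch.msg u (C.state u) (Sch.prover C u) w).length ≤ κ

/-- The family `F_m` of connected configurations for matching verification:
the state of each node `v` is an indication `I_v(e)` per incident edge
(a Boolean per port), with at most one incident edge marked `true`. -/
def Fm {V : Type} [Fintype V] : Set (Config V (V → Bool)) :=
  {C | ∀ v : V, ((nbrsG C.G v).filter fun w => C.state v w = true).card ≤ 1}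

/-- The matching-verification predicate MV: the set of marked edges is well
defined (both endpoints agree on every edge), and it is a matching. -/
def MVPred {V : Type} (C : Config V (V → Bool)) : Prop :=
  (∀ v w : V, C.G.Adj v w → C.state v w = C.state w v) ∧
  (∀ v w w' : V, C.G.Adj v w → C.G.Adj v w' →
    C.state v w = true → C.state v w' = true → w = w')

/-- A graph in which every vertex has at most `k` neighbors has a proper coloring with colors
`0, …, k`. -/
theorem exists_coloring_le {V : Type} [Fintype V] (G : SimpleGraph V) (k : ℕ)
    (hk : ∀ v, degOf G v ≤ k) :
    ∃ c : V → ℕ, (∀ v, c v ≤ k) ∧ ∀ v w, G.Adj v w → c v ≠ c w := by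
  suffices h : ∀ s : Finset V, ∃ c : V → ℕ, (∀ v, c v ≤ k) ∧
      ∀ v ∈ s, ∀ w ∈ s, G.Adj v w → c v ≠ c w by
    obtain ⟨c, hc, hp⟩ := h Finset.univ
    exact ⟨c, hc, fun v w => hp v (Finset.mem_univ v) w (Finset.mem_univ w)⟩
  intro s
  induction s using Finset.induction_on with
  | empty => exact ⟨fun _ => 0, by simp, by simp⟩
  | insert a s ha ih =>
    obtain ⟨c, hc, hp⟩ := ih
    obtain ⟨m, hm, hm'⟩ : ∃ m ∈ Finset.range (k + 1), m ∉ (nbrsG G a).image c := by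
      apply Finset.exists_mem_notMem_of_card_lt_card
      rw [Finset.card_range]
      exact Nat.lt_succ_of_le (Finset.card_image_le.trans (hk a))
    have hne : ∀ w, G.Adj a w → m ≠ c w := by
      rintro w hw rfl
      exact hm' (Finset.mem_image_of_mem c (by simpa [nbrsG] using hw))
    have hs : ∀ v ∈ s, v ≠ a := fun v hv h => ha (h ▸ hv)
    refine ⟨Function.update c a m, fun v => ?_, fun v hv w hw hvw => ?_⟩
    · by_cases h : v = a
      · subst h
        simpa [Nat.lt_succ_iff] using hm
      · simpa [h] using hc v
    · rcases Finset.mem_insert.1 hv with rfl | hv' <;> rcases Finset.mem_insert.1 hw with rfl | hw'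
      · exact absurd hvw (G.loopless.irrefl _)
      · simpa [hs w hw'] using hne w hvw
      · simpa [hs v hv'] using (hne v hvw.symm).symm
      · simpa [hs v hv', hs w hw'] using hp v hv' w hw' hvw

/-- The graph joining distinct vertices that have a common neighbor. -/
def commonNbrGraph {V : Type} (G : SimpleGraph V) : SimpleGraph V where
  Adj v w := v ≠ w ∧ ∃ u, G.Adj u v ∧ G.Adj u w
  symm := ⟨fun _ _ ⟨hne, u, hv, hw⟩ => ⟨hne.symm, u, hw, hv⟩⟩
  loopless := ⟨fun _ h => h.1 rfl⟩

theorem degOf_le_maxDeg {V : Type} [Fintype V] (G : SimpleGraph V) (v : V) :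
    degOf G v ≤ maxDeg G :=
  Finset.le_sup (f := degOf G) (Finset.mem_univ v)

theorem degOf_commonNbrGraph_le {V : Type} [Fintype V] (G : SimpleGraph V) (v : V) :
    degOf (commonNbrGraph G) v ≤ maxDeg G * maxDeg G := by
  have hsub : nbrsG (commonNbrGraph G) v ⊆ (nbrsG G v).biUnion (nbrsG G) := by
    intro w hw
    obtain ⟨-, u, hv, hw⟩ : (commonNbrGraph G).Adj v w := by simpa [nbrsG] using hw
    simpa [nbrsG] using ⟨u, hv.symm, hw⟩
  calc degOf (commonNbrGraph G) v ≤ ((nbrsG G v).biUnion (nbrsG G)).card :=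
        Finset.card_le_card hsub
    _ ≤ degOf G v * maxDeg G :=
        Finset.card_biUnion_le_card_mul _ _ _ fun u _ => degOf_le_maxDeg G u
    _ ≤ maxDeg G * maxDeg G := Nat.mul_le_mul_right _ (degOf_le_maxDeg G v)

theorem exists_nbr_injective_coloring {V : Type} [Fintype V] (G : SimpleGraph V) :
    ∃ c : V → ℕ, (∀ v, c v ≤ maxDeg G * maxDeg G) ∧
      ∀ u v w, G.Adj u v → G.Adj u w → c v = c w → v = w := by
  obtain ⟨c, hc, hp⟩ := exists_coloring_le (commonNbrGraph G) _ (degOf_commonNbrGraph_le G)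
  refine ⟨c, hc, fun u v w hv hw h => ?_⟩
  by_contra hne
  exact hp v w ⟨hne, u, hv, hw⟩ h

/-- A coloring that is injective on every neighborhood and uses at most `Δ² + 1` colors. -/
noncomputable def nbrColor {V : Type} [Fintype V] (G : SimpleGraph V) : V → ℕ :=
  (exists_nbr_injective_coloring G).choose

/-- The natural number with the given binary digits, least significant first. -/
def natOfBits : List Bool → ℕ :=
  List.foldr Nat.bit 0

theorem natOfBits_bits (n : ℕ) : natOfBits n.bits = n := by
  induction n using Nat.binaryRec' with
  | zero => simp [natOfBits]
  | bit b n h ih =>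
    rw [Nat.bits_append_bit n b h]
    exact congrArg (Nat.bit b) ih

/-- The pair of natural numbers encoded by a bit string. -/
def decodePair (l : List Bool) : ℕ × ℕ :=
  (natOfBits l).unpair

/-- The color of the mate of `u` plus one, or `0` if `u` is unmatched. -/
noncomputable def mateColor {V : Type} [Fintype V] (C : Config V (V → Bool)) (u : V) : ℕ :=
  if h : ∃ w, C.G.Adj u w ∧ C.state u w = true then nbrColor C.G h.choose + 1 else 0

/-- Every node broadcasts its label, preceded by a bit that makes the message nonempty. Labels
encode the color of the node and the color of its mate. -/
noncomputable def mvScheme (V : Type) [Fintype V] : Scheme V (V → Bool) where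
  prover C u := (Nat.pair (nbrColor C.G u) (mateColor C u)).bits
  msg _ _ l _ := true :: l
  out _ s l rec := decide (∀ x, rec x ≠ [] →
    (s x = true ↔ (decodePair l).2 = (decodePair (rec x).tail).1 + 1) ∧
    (s x = true → (decodePair (rec x).tail).2 = (decodePair l).1 + 1))

theorem accepts_mvScheme_iff {V : Type} [Fintype V] (C : Config V (V → Bool))
    (l : V → List Bool) :
    Accepts (mvScheme V) C l ↔ ∀ u x, C.G.Adj u x →
      (C.state u x = true ↔ (decodePair (l u)).2 = (decodePair (l x)).1 + 1) ∧
      (C.state u x = true → (decodePair (l x)).2 = (decodePair (l u)).1 + 1) := by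
  simp only [Accepts, mvScheme, received, decide_eq_true_eq]
  refine forall_congr' fun u => forall_congr' fun x => ?_
  by_cases h : C.G.Adj u x <;> simp [h]

theorem mateColor_eq {V : Type} [Fintype V] {C : Config V (V → Bool)} (hC : MVPred C)
    {u w : V} (hw : C.G.Adj u w) (hs : C.state u w = true) :
    mateColor C u = nbrColor C.G w + 1 := by
  have h : ∃ w, C.G.Adj u w ∧ C.state u w = true := ⟨w, hw, hs⟩
  rw [mateColor, dif_pos h, hC.2 u _ w h.choose_spec.1 hw h.choose_spec.2 hs]

theorem state_of_mateColor_eq {V : Type} [Fintype V] {C : Config V (V → Bool)}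
    {u x : V} (hx : C.G.Adj u x) (h : mateColor C u = nbrColor C.G x + 1) :
    C.state u x = true := by
  by_cases hw : ∃ w, C.G.Adj u w ∧ C.state u w = true
  · rw [mateColor, dif_pos hw] at h
    rw [← (exists_nbr_injective_coloring C.G).choose_spec.2 u _ x hw.choose_spec.1 hx
      (Nat.succ_injective h)]
    exact hw.choose_spec.2
  · simp [mateColor, hw] at h

theorem mvScheme_complete {V : Type} [Fintype V] {C : Config V (V → Bool)} (hC : MVPred C) :
    Accepts (mvScheme V) C ((mvScheme V).prover C) := by
  rw [accepts_mvScheme_iff]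
  intro u x hx
  simp only [mvScheme, decodePair, natOfBits_bits, Nat.unpair_pair]
  exact ⟨⟨mateColor_eq hC hx, state_of_mateColor_eq hx⟩,
    fun h => mateColor_eq hC hx.symm (hC.1 u x hx ▸ h)⟩

theorem mvScheme_sound {V : Type} [Fintype V] {C : Config V (V → Bool)} (hF : C ∈ Fm)
    {l : V → List Bool} (h : Accepts (mvScheme V) C l) : MVPred C := by
  rw [accepts_mvScheme_iff] at h
  have himp : ∀ v w, C.G.Adj v w → C.state v w = true → C.state w v = true :=
    fun v w hvw hs => (h w v hvw.symm).1.2 ((h v w hvw).2 hs)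
  refine ⟨fun v w hvw => Bool.eq_iff_iff.2 ⟨himp v w hvw, himp w v hvw.symm⟩,
    fun v w w' hw hw' hs hs' => ?_⟩
  exact Finset.card_le_one.1 (hF v) w (by simp [nbrsG, hw, hs]) w' (by simp [nbrsG, hw', hs'])

theorem mateColor_le {V : Type} [Fintype V] (C : Config V (V → Bool)) (u : V) :
    mateColor C u ≤ maxDeg C.G * maxDeg C.G + 1 := by
  unfold mateColor
  split_ifs with h
  · exact Nat.succ_le_succ ((exists_nbr_injective_coloring C.G).choose_spec.1 _)
  · exact Nat.zero_le _

theorem pair_nbrColor_mateColor_lt {V : Type} [Fintype V] (C : Config V (V → Bool)) (u : V) :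
    Nat.pair (nbrColor C.G u) (mateColor C u) < (maxDeg C.G + 2) ^ 4 := by
  have hc : nbrColor C.G u ≤ maxDeg C.G * maxDeg C.G :=
    (exists_nbr_injective_coloring C.G).choose_spec.1 u
  have hmax : max (nbrColor C.G u) (mateColor C u) + 1 ≤ (maxDeg C.G + 2) ^ 2 := by
    have := max_le (hc.trans (Nat.le_succ _)) (mateColor_le C u)
    nlinarith
  calc Nat.pair (nbrColor C.G u) (mateColor C u)
      < (max (nbrColor C.G u) (mateColor C u) + 1) ^ 2 := Nat.pair_lt_max_add_one_sq _ _
    _ ≤ ((maxDeg C.G + 2) ^ 2) ^ 2 := Nat.pow_le_pow_left hmax 2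
    _ = (maxDeg C.G + 2) ^ 4 := by ring

theorem size_le_logb_add_one {n : ℕ} {b : ℕ} (k : ℕ) (hb : 1 ≤ b) (h : n < b ^ k) :
    (n.size : ℝ) ≤ k * Real.logb 2 b + 1 := by
  have hb' : (1 : ℝ) ≤ b := by exact_mod_cast hb
  have hlog : 0 ≤ Real.logb 2 b := Real.logb_nonneg one_lt_two hb'
  rcases hs : n.size with _ | m
  · push_cast
    positivity
  · have hm : 2 ^ m ≤ n := Nat.lt_size.1 (by omega)
    have hpow : (2 : ℝ) ^ m ≤ (b : ℝ) ^ k := by exact_mod_cast hm.trans h.le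
    have := Real.logb_le_logb_of_le one_lt_two (by positivity) hpow
    rw [Real.logb_pow, Real.logb_pow, Real.logb_self_eq_one one_lt_two] at this
    push_cast
    linarith

theorem length_msg_mvScheme_le {V : Type} [Fintype V] (C : Config V (V → Bool)) (u w : V) :
    (((mvScheme V).msg u (C.state u) ((mvScheme V).prover C u) w).length : ℝ) ≤
      6 * Real.logb 2 ((maxDeg C.G : ℝ) + 2) := by
  have hsize := size_le_logb_add_one 4 (by omega) (pair_nbrColor_mateColor_lt C u)
  have hlog : 1 ≤ Real.logb 2 ((maxDeg C.G : ℝ) + 2) := by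
    rw [Real.le_logb_iff_rpow_le one_lt_two (by positivity), Real.rpow_one]
    linarith [(maxDeg C.G).cast_nonneg (α := ℝ)]
  simp only [mvScheme, List.length_cons, Nat.size_eq_bits_len]
  push_cast at hsize ⊢
  linarith

theorem mcast_mvScheme {V : Type} [Fintype V] (F : Set (Config V (V → Bool))) :
    Mcast F 1 (mvScheme V) := by
  intro C _ l u
  refine Finset.card_le_one.2 fun a ha b hb => ?_
  simp only [mvScheme, Finset.mem_image] at ha hb
  obtain ⟨_, _, rfl⟩ := ha
  obtain ⟨_, _, rfl⟩ := hb
  rfl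

/-- There exists a proof-labeling scheme for `(F_m, MV)` in the
broadcast model with verification complexity `O(log Δ)`: there is a constant `c`
such that for every vertex set there is a scheme whose messages, on every legal
configuration of maximum degree `Δ`, have length at most `c·log₂(Δ+2)`. -/
theorem mv_broadcast_upper :
    ∃ c : ℝ, 0 < c ∧
      ∀ (V : Type) [Fintype V] [DecidableEq V],
        ∃ Sch : Scheme V (V → Bool),
          IsPLS Fm MVPred 1 Sch ∧
          ∀ C ∈ (Fm : Set (Config V (V → Bool))), MVPred C →
            ∀ u w : V, C.G.Adj u w →
              ((Sch.msg u (C.state u) (Sch.prover C u) w).length : ℝ) ≤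
                c * Real.logb 2 ((maxDeg C.G : ℝ) + 2) := by
  exact ⟨6, by norm_num, fun V _ _ => ⟨mvScheme V,
    ⟨mcast_mvScheme Fm, fun _ _ hC => mvScheme_complete hC,
      fun _ hF hC _ h => hC (mvScheme_sound hF h)⟩,
    fun C _ _ u w _ => length_msg_mvScheme_le C u w⟩⟩
end

section
/- There exists a constant c > 0 such that for every n and every 1 ≤ k ≤ 2^{c·n}, every proof-labeling scheme for the k-maximum-flow problem (F_st, k-MF), even in the unicast model, has verification complexity at least (1/4)·log₂ k on some n-node configurations in F_st; moreover this holds even when the configurations are restricted to graphs of constant maximum degree. Hence the verification complexity of (F_st, k-MF) in the unicast model is Ω(log k). -/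
open scoped Classical

/-- `f` is a legal `s`–`t` flow in `G` with capacities `cap`: anti-symmetry,
capacity compliance, and flow conservation at all nodes other than `s`, `t`. -/
def IsFlow {V : Type} [Fintype V] (G : SimpleGraph V) (cap : V → V → ℕ)
    (s t : V) (f : V → V → ℤ) : Prop :=
  (∀ u w : V, G.Adj u w → f u w = - f w u) ∧
  (∀ u w : V, G.Adj u w → |f u w| ≤ (cap u w : ℤ)) ∧
  (∀ u : V, u ≠ s → u ≠ t → ∑ w ∈ nbrsG G u, f u w = 0)

/-- The value of the flow `f`: the net flow out of the source `s`. -/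
noncomputable def flowVal {V : Type} [Fintype V] (G : SimpleGraph V)
    (s : V) (f : V → V → ℤ) : ℤ :=
  ∑ w ∈ nbrsG G s, f s w

/-- The family `F_st` over the graph `G` (with distinguished source `s` and sink
`t`): the state of each node holds a natural-number capacity for each incident
edge, agreeing at both endpoints. -/
def Fstk {V : Type} [Fintype V] (G : SimpleGraph V) (s t : V) :
    Set (Config V (V → ℕ)) :=
  {C | C.G = G ∧ ∀ u w : V, G.Adj u w → C.state u w = C.state w u}

/-- The `k`-maximum-flow predicate: the maximum `s`–`t` flow value in the
capacitated graph equals exactly `k`. -/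
def kMF {V : Type} [Fintype V] (G : SimpleGraph V) (s t : V) (k : ℕ)
    (C : Config V (V → ℕ)) : Prop :=
  (∃ f : V → V → ℤ, IsFlow G (fun u w => C.state u w) s t f ∧ flowVal G s f = (k : ℤ)) ∧
  (∀ f : V → V → ℤ, IsFlow G (fun u w => C.state u w) s t f → flowVal G s f ≤ (k : ℤ))

/-- Adjacency of the ladder with rails `0 – 1 – 2 – 3 – 4` and `5 – 6 – 7 – 8 – 9`, rungs
`i – (i + 5)`, and a tail `9 – 10 – 11 – ⋯`. -/
def LadderAdj (i j : ℕ) : Prop :=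
  (i + 1 = j ∧ i ≠ 4) ∨ (j + 1 = i ∧ j ≠ 4) ∨ (i + 5 = j ∧ i < 5) ∨ (j + 5 = i ∧ j < 5)

/-- The ladder with a tail, on `n` nodes. -/
def ladder (n : ℕ) : SimpleGraph (Fin n) where
  Adj u w := LadderAdj u w
  symm := ⟨fun u w h => by unfold LadderAdj at *; omega⟩
  loopless := ⟨fun u h => by unfold LadderAdj at h; omega⟩

theorem ladder_connected {n : ℕ} (hn : 10 ≤ n) : (ladder n).Connected := by
  have key : ∀ (i : ℕ) (hi : i < n), (ladder n).Reachable ⟨i, hi⟩ ⟨0, by omega⟩ := by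
    intro i
    induction i with
    | zero => intro hi; exact SimpleGraph.Reachable.refl _
    | succ i ih =>
      intro hi
      by_cases h4 : i = 4
      · subst h4
        exact SimpleGraph.Adj.reachable (show LadderAdj _ _ by simp [LadderAdj])
      · exact (SimpleGraph.Adj.reachable (show LadderAdj (i + 1) i by
          unfold LadderAdj; omega)).trans (ih (by omega))
  have : Nonempty (Fin n) := ⟨⟨0, by omega⟩⟩
  exact ⟨fun u w => (key u u.2).trans (key w w.2).symm⟩

/-- A graph whose edges join numbers at distance `1` or `5` has maximum degree at most `4`. -/
theorem maxDeg_le_four {n : ℕ} (G : SimpleGraph (Fin n))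
    (h : ∀ u w : Fin n, G.Adj u w →
      u.val + 1 = w ∨ w.val + 1 = u ∨ u.val + 5 = w ∨ w.val + 5 = u) :
    maxDeg G ≤ 4 := by
  refine Finset.sup_le fun u _ => ?_
  have hsub : (nbrsG G u).image Fin.val ⊆ {u.val + 1, u.val - 1, u.val + 5, u.val - 5} := by
    intro i hi
    obtain ⟨w, hw, rfl⟩ := Finset.mem_image.1 hi
    have := h u w (Finset.mem_filter.1 hw).2
    simp only [Finset.mem_insert, Finset.mem_singleton]
    omega
  rw [degOf, ← Finset.card_image_of_injective _ Fin.val_injective]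
  exact (Finset.card_le_card hsub).trans Finset.card_le_four

/-- Capacities on the ladder: `a` on the first rail, `b` on the second rail, `k` on the rungs,
and `0` on the tail. -/
def ladderCap {n : ℕ} (k : ℕ) (a b : ℕ → ℕ) (u w : Fin n) : ℕ :=
  if u.val < 5 then (if w.val < 5 then a (min u.val w.val) else k)
  else if w.val < 5 then k
  else if u.val ≤ 9 ∧ w.val ≤ 9 then b (min u.val w.val - 5) else 0

theorem ladderCap_comm {n : ℕ} (k : ℕ) (a b : ℕ → ℕ) (u w : Fin n) :
    ladderCap k a b u w = ladderCap k a b w u := by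
  unfold ladderCap
  rw [min_comm]
  split_ifs <;> first | rfl | omega

/-- The ladder with the capacities `ladderCap`. -/
def ladderConfig {n : ℕ} (hn : 10 ≤ n) (k : ℕ) (a b : ℕ → ℕ) : Config (Fin n) (Fin n → ℕ) where
  G := ladder n
  connected := ladder_connected hn
  state := ladderCap k a b

/-- The forward part of the flow on the ladder routing `a i` units over the `i`-th edge of the
first rail and `k - a i` units over the `i`-th edge of the second rail. -/
def forwardFlow (k : ℕ) (a : ℕ → ℕ) (i j : ℕ) : ℤ :=
  if j = i + 1 then
    (if i < 4 then (a i : ℤ) else if 5 ≤ i ∧ i < 9 then (k : ℤ) - a (i - 5) else 0)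
  else if j = i + 5 ∧ i < 5 then
    (if i = 0 then (k : ℤ) else a (i - 1)) - (if i = 4 then 0 else (a i : ℤ))
  else 0

theorem sum_nbrsG_ladder {n : ℕ} (hn : 10 ≤ n) (φ : ℕ → ℕ → ℤ) (u : Fin n)
    (hφ : ∀ j, 10 ≤ j → LadderAdj u j → φ u j = 0) :
    ∑ w ∈ nbrsG (ladder n) u, φ u w =
      ∑ j ∈ Finset.range 10, if LadderAdj u j then φ u j else 0 := by
  rw [nbrsG, Finset.sum_filter]
  change ∑ w : Fin n, (fun j : ℕ => if LadderAdj u j then φ u j else 0) w = _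
  rw [Fin.sum_univ_eq_sum_range (fun j : ℕ => if LadderAdj u j then φ u j else 0)]
  symm
  refine Finset.sum_subset (Finset.range_subset_range.2 hn) fun j _ hj => ?_
  split_ifs with h
  · exact hφ j (by simpa using hj) h
  · rfl

theorem sum_forwardFlow {n : ℕ} (hn : 10 ≤ n) (k : ℕ) (a : ℕ → ℕ) (u : Fin n) (hu : u.val ≠ 9) :
    ∑ w ∈ nbrsG (ladder n) u, (forwardFlow k a u w - forwardFlow k a w u) =
      if u.val = 0 then (k : ℤ) else 0 := by
  rw [sum_nbrsG_ladder hn (fun i j => forwardFlow k a i j - forwardFlow k a j i) u]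
  · obtain ⟨i, hi⟩ := u
    by_cases h : i < 10
    · dsimp only at hu ⊢
      interval_cases i <;>
        simp [Finset.sum_range_succ, LadderAdj, forwardFlow] at hu ⊢
    · have h0 : i ≠ 0 := by omega
      simp only [h0, if_false]
      refine Finset.sum_eq_zero fun j hj => ?_
      rw [Finset.mem_range] at hj
      split_ifs with hadj
      · unfold LadderAdj at hadj
        unfold forwardFlow
        split_ifs <;> omega
      · rfl
  · intro j hj hadj
    unfold LadderAdj at hadj
    unfold forwardFlow
    split_ifs <;> omega

theorem isFlow_forwardFlow {n : ℕ} (hn : 10 ≤ n) {k : ℕ} {a : ℕ → ℕ} (ha : ∀ i, a i ≤ k) :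
    IsFlow (ladder n) (ladderCap k a fun i => k - a i) ⟨0, by omega⟩ ⟨9, by omega⟩
      (fun u w => forwardFlow k a u w - forwardFlow k a w u) := by
  refine ⟨fun u w _ => by ring, fun u w h => ?_, fun u hs ht => ?_⟩
  · have key : ∀ i j : Fin n, i < j → LadderAdj i j →
        |forwardFlow k a i j - forwardFlow k a j i| ≤
          (ladderCap k a (fun i => k - a i) i j : ℤ) := by
      intro i j hij h
      rw [Fin.lt_def] at hij
      obtain ⟨i, hi⟩ := i
      obtain ⟨j, hj⟩ := j
      dsimp only at hij h ⊢
      have h1 := ha i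
      have h2 := ha (i - 1)
      have h3 := ha (i - 5)
      have hmin : min i j = i := by omega
      unfold LadderAdj at h
      unfold forwardFlow ladderCap
      dsimp only
      rw [abs_le, hmin]
      split_ifs <;> constructor <;> omega
    rcases lt_trichotomy u w with hlt | heq | hgt
    · exact key u w hlt h
    · subst heq
      exact absurd h ((ladder n).loopless.irrefl u)
    · rw [abs_sub_comm, ladderCap_comm]
      exact key w u hgt h.symm
  · rw [sum_forwardFlow hn k a u fun h => ht (Fin.ext h), if_neg fun h => hs (Fin.ext h)]

/-- The value of a flow is the net flow across any cut. -/
theorem flowVal_eq_cut {V : Type} [Fintype V] [DecidableEq V] {G : SimpleGraph V} {cap : V → V → ℕ} {s t : V}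
    {f : V → V → ℤ} (hf : IsFlow G cap s t f) (S : Finset V) (hs : s ∈ S) (ht : t ∉ S) :
    flowVal G s f = ∑ u ∈ S, ∑ w ∈ Sᶜ, (if G.Adj u w then f u w else 0) := by
  have hanti : ∀ u w, (if G.Adj u w then f u w else 0) = -(if G.Adj w u then f w u else 0) := by
    intro u w
    by_cases h : G.Adj u w
    · rw [if_pos h, if_pos h.symm, hf.1 u w h]
    · rw [if_neg h, if_neg fun h' => h h'.symm, neg_zero]
  have hinner : ∑ u ∈ S, ∑ w ∈ S, (if G.Adj u w then f u w else 0) = 0 := by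
    have h : ∑ u ∈ S, ∑ w ∈ S, (if G.Adj u w then f u w else 0) =
        -∑ u ∈ S, ∑ w ∈ S, (if G.Adj u w then f u w else 0) := by
      conv_lhs => rw [Finset.sum_comm]
      simp only [← Finset.sum_neg_distrib]
      exact Finset.sum_congr rfl fun u _ => Finset.sum_congr rfl fun w _ => hanti w u
    omega
  have htotal : ∑ u ∈ S, ∑ w ∈ nbrsG G u, f u w = flowVal G s f :=
    Finset.sum_eq_single_of_mem s hs fun u hu hne =>
      hf.2.2 u hne fun h => ht (h ▸ hu)
  rw [← htotal, ← zero_add (∑ u ∈ S, ∑ w ∈ Sᶜ, _)]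
  refine Eq.trans ?_ (congrArg (· + _) hinner)
  rw [← Finset.sum_add_distrib]
  refine Finset.sum_congr rfl fun u _ => ?_
  rw [Finset.sum_add_sum_compl, nbrsG, Finset.sum_filter]

/-- Every flow on the ladder is bounded by the cut through the `j`-th edges of the two rails. -/
theorem flowVal_le_rails {n : ℕ} (hn : 10 ≤ n) {k : ℕ} {a b : ℕ → ℕ} {f : Fin n → Fin n → ℤ}
    (hf : IsFlow (ladder n) (ladderCap k a b) ⟨0, by omega⟩ ⟨9, by omega⟩ f)
    {j : ℕ} (hj : j < 4) :
    flowVal (ladder n) ⟨0, by omega⟩ f ≤ (a j : ℤ) + b j := by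
  set S : Finset (Fin n) :=
    Finset.univ.filter fun u => u.val ≤ j ∨ (5 ≤ u.val ∧ u.val ≤ 5 + j) with hS
  rw [flowVal_eq_cut hf S (by simp [hS]) (by simp [hS]; omega)]
  have hbound : ∀ u ∈ S, ∀ w ∈ Sᶜ, (if (ladder n).Adj u w then f u w else 0) ≤
      (if u = ⟨j, by omega⟩ then (if w = ⟨j + 1, by omega⟩ then (a j : ℤ) else 0) else 0) +
      (if u = ⟨5 + j, by omega⟩ then (if w = ⟨6 + j, by omega⟩ then (b j : ℤ) else 0) else 0) := by
    intro u hu w hw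
    simp only [hS, Finset.mem_compl, Finset.mem_filter, Finset.mem_univ, true_and] at hu hw
    by_cases hadj : (ladder n).Adj u w
    · have hcap := (le_abs_self _).trans (hf.2.1 u w hadj)
      have hadj' : LadderAdj u w := hadj
      rw [if_pos hadj]
      have hcases : (u.val = j ∧ w.val = j + 1) ∨ (u.val = 5 + j ∧ w.val = 6 + j) := by
        unfold LadderAdj at hadj'
        omega
      rcases hcases with ⟨h1, h2⟩ | ⟨h1, h2⟩
      · have hu' : u = ⟨j, by omega⟩ := Fin.ext h1
        have hw' : w = ⟨j + 1, by omega⟩ := Fin.ext h2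
        have hc : ladderCap k a b u w = a j := by
          unfold ladderCap
          rw [if_pos (by omega), if_pos (by omega), h1, h2, min_eq_left (by omega)]
        rw [hc] at hcap
        rw [if_pos hu', if_pos hw', if_neg (by simp [hu'])]
        simpa using hcap
      · have hu' : u = ⟨5 + j, by omega⟩ := Fin.ext h1
        have hw' : w = ⟨6 + j, by omega⟩ := Fin.ext h2
        have hc : ladderCap k a b u w = b j := by
          unfold ladderCap
          rw [if_neg (by omega), if_neg (by omega), if_pos (by omega), h1, h2,
            min_eq_left (by omega), Nat.add_sub_cancel_left]
        rw [hc] at hcap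
        rw [if_neg (by simp [hu']), if_pos hu', if_pos hw']
        simpa using hcap
    · rw [if_neg hadj]
      split_ifs <;> positivity
  refine (Finset.sum_le_sum fun u hu => Finset.sum_le_sum fun w hw => hbound u hu w hw).trans ?_
  simp only [Finset.sum_add_distrib]
  refine add_le_add ?_ ?_
  all_goals
    rw [Finset.sum_comm]
    simp only [Finset.sum_ite_eq']
    split_ifs
    · simp only [Finset.sum_ite_eq']
      split_ifs <;> simp
    · simp

theorem ladderConfig_mem {n : ℕ} (hn : 10 ≤ n) (k : ℕ) (a b : ℕ → ℕ) (s t : Fin n) :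
    ladderConfig hn k a b ∈ Fstk (ladder n) s t :=
  ⟨rfl, fun u w _ => ladderCap_comm k a b u w⟩

theorem kMF_ladderConfig {n : ℕ} (hn : 10 ≤ n) {k : ℕ} {a : ℕ → ℕ} (ha : ∀ i, a i ≤ k) :
    kMF (ladder n) ⟨0, by omega⟩ ⟨9, by omega⟩ k (ladderConfig hn k a fun i => k - a i) := by
  refine ⟨⟨_, isFlow_forwardFlow hn ha, ?_⟩, fun f hf => ?_⟩
  · exact sum_forwardFlow hn k a ⟨0, by omega⟩ (by simp)
  · have h := flowVal_le_rails hn (k := k) (a := a) (b := fun i => k - a i) hf (j := 0) (by omega)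
    have := ha 0
    omega

theorem not_kMF_ladderConfig {n : ℕ} (hn : 10 ≤ n) {k : ℕ} {a b : ℕ → ℕ} {j : ℕ} (hj : j < 4)
    (hlt : a j + b j < k) :
    ¬ kMF (ladder n) ⟨0, by omega⟩ ⟨9, by omega⟩ k (ladderConfig hn k a b) := by
  rintro ⟨⟨f, hf, hval⟩, -⟩
  have h := flowVal_le_rails hn (k := k) (a := a) (b := b) hf hj
  omega

/-- If two labelled ladders are accepted and exchange the same messages over all rungs, then
the first rail of one can be combined with the second rail of the other. -/
theorem accepts_splice {n : ℕ} (hn : 10 ≤ n) {k : ℕ} {a b a' b' : ℕ → ℕ}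
    {Sch : Scheme (Fin n) (Fin n → ℕ)} {l l' : Fin n → List Bool}
    (h : Accepts Sch (ladderConfig hn k a b) l) (h' : Accepts Sch (ladderConfig hn k a' b') l')
    (hmsg : ∀ u w : Fin n, u.val < 5 → w.val = u.val + 5 →
      Sch.msg u (ladderCap k a b u) (l u) w = Sch.msg u (ladderCap k a' b' u) (l' u) w ∧
      Sch.msg w (ladderCap k a b w) (l w) u = Sch.msg w (ladderCap k a' b' w) (l' w) u) :
    Accepts Sch (ladderConfig hn k a b') (fun u => if u.val < 5 then l u else l' u) := by
  have hA : ∀ u : Fin n, u.val < 5 → ladderCap k a b' u = ladderCap k a b u := by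
    intro u hu
    funext w
    simp [ladderCap, hu]
  have hB : ∀ u : Fin n, ¬ u.val < 5 → ladderCap k a b' u = ladderCap k a' b' u := by
    intro u hu
    funext w
    simp [ladderCap, hu]
  intro u
  by_cases hu : u.val < 5
  · rw [← h u]
    dsimp only [ladderConfig]
    rw [hA u hu, if_pos hu]
    congr 1
    funext w
    dsimp only [received, ladderConfig]
    by_cases hadj : (ladder n).Adj u w
    · rw [if_pos hadj, if_pos hadj]
      by_cases hw : w.val < 5
      · rw [hA w hw, if_pos hw]
      · rw [hB w hw, if_neg hw]
        have hadj' : LadderAdj u w := hadj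
        unfold LadderAdj at hadj'
        exact (hmsg u w hu (by omega)).2.symm
    · rw [if_neg hadj, if_neg hadj]
  · rw [← h' u]
    dsimp only [ladderConfig]
    rw [hB u hu, if_neg hu]
    congr 1
    funext w
    dsimp only [received, ladderConfig]
    by_cases hadj : (ladder n).Adj u w
    · rw [if_pos hadj, if_pos hadj]
      by_cases hw : w.val < 5
      · rw [hA w hw, if_pos hw]
        have hadj' : LadderAdj u w := hadj
        unfold LadderAdj at hadj'
        exact (hmsg w u hw (by omega)).1
      · rw [hB w hw, if_neg hw]
    · rw [if_neg hadj, if_neg hadj]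

/-- Families of bit strings of length at most `κ` that separate the points of `ι` bound the
cardinality of `ι`. -/
theorem card_le_of_injective_strings {ι β : Type} [Fintype ι] [Fintype β] {κ : ℕ}
    (T : ι → β → List Bool) (hlen : ∀ x y, (T x y).length ≤ κ) (hT : Function.Injective T) :
    Fintype.card ι ≤ (2 ^ (κ + 1) - 1) ^ Fintype.card β := by
  let e : ι → β → (Σ i : Fin (κ + 1), List.Vector Bool i) := fun x y =>
    ⟨⟨(T x y).length, Nat.lt_succ_of_le (hlen x y)⟩, ⟨T x y, rfl⟩⟩
  have he : Function.Injective e := by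
    intro x x' h
    apply hT
    funext y
    exact congrArg (fun p : (Σ i : Fin (κ + 1), List.Vector Bool i) => p.2.toList) (congrFun h y)
  have hc := Fintype.card_le_of_injective e he
  rw [Fintype.card_fun, Fintype.card_sigma] at hc
  simp only [card_vector, Fintype.card_bool] at hc
  rwa [Fin.sum_univ_eq_sum_range (fun i => 2 ^ i), Nat.geomSum_eq le_rfl, Nat.div_one] at hc

/-- On the ladder, the messages over the five rungs determine the flow on the first rail. -/
theorem ladder_count {n : ℕ} (hn : 10 ≤ n) {k κ r : ℕ} {Sch : Scheme (Fin n) (Fin n → ℕ)}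
    (hP : IsPLS (Fstk (ladder n) ⟨0, by omega⟩ ⟨9, by omega⟩)
      (kMF (ladder n) ⟨0, by omega⟩ ⟨9, by omega⟩ k) r Sch)
    (hV : VCBound (Fstk (ladder n) ⟨0, by omega⟩ ⟨9, by omega⟩)
      (kMF (ladder n) ⟨0, by omega⟩ ⟨9, by omega⟩ k) Sch κ) :
    (k + 1) ^ 4 ≤ (2 ^ (κ + 1) - 1) ^ 10 := by
  let rail : (Fin 4 → Fin (k + 1)) → ℕ → ℕ := fun x i => if h : i < 4 then x ⟨i, h⟩ else 0
  have hrail : ∀ x i, rail x i ≤ k := by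
    intro x i
    dsimp only [rail]
    split_ifs with h
    · exact Nat.le_of_lt_succ (x ⟨i, h⟩).2
    · exact Nat.zero_le k
  let C : (Fin 4 → Fin (k + 1)) → Config (Fin n) (Fin n → ℕ) := fun x =>
    ladderConfig hn k (rail x) fun i => k - rail x i
  have hyes := fun x => kMF_ladderConfig hn (hrail x)
  have hmem : ∀ x, C x ∈ Fstk (ladder n) ⟨0, by omega⟩ ⟨9, by omega⟩ := fun x =>
    ladderConfig_mem hn k _ _ _ _
  have hacc : ∀ x, Accepts Sch (C x) (Sch.prover (C x)) := fun x => hP.2.1 _ (hmem x) (hyes x)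
  let M : (Fin 4 → Fin (k + 1)) → Fin n → Fin n → List Bool := fun x u w =>
    Sch.msg u ((C x).state u) (Sch.prover (C x) u) w
  let up : Fin 5 → Fin n := fun i => ⟨i, by omega⟩
  let down : Fin 5 → Fin n := fun i => ⟨i + 5, by omega⟩
  have hadj : ∀ i, (ladder n).Adj (up i) (down i) := by
    intro i
    change LadderAdj i (i + 5)
    unfold LadderAdj
    omega
  let T : (Fin 4 → Fin (k + 1)) → Fin 5 ⊕ Fin 5 → List Bool := fun x =>
    Sum.elim (fun i => M x (up i) (down i)) (fun i => M x (down i) (up i))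
  have hT : Function.Injective T := by
    have key : ∀ x x', T x = T x' → ∀ j, ¬ x j < x' j := by
      intro x x' h j hlt
      have hlt' : (x j).val < (x' j).val := hlt
      have hj : rail x j = x j := by simp [rail]
      have hj' : rail x' j = x' j := by simp [rail]
      refine hP.2.2 _ (ladderConfig_mem hn k (rail x) (fun i => k - rail x' i) _ _)
        (not_kMF_ladderConfig hn (j := j) j.2 ?_) _ (accepts_splice hn (hacc x) (hacc x') ?_)
      · have := hrail x' j
        omega
      · intro u w hu hw
        have hu' : u = up ⟨u, hu⟩ := rfl
        have hw' : w = down ⟨u, hu⟩ := Fin.ext hw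
        have h1 := congrFun h (Sum.inl ⟨u, hu⟩)
        have h2 := congrFun h (Sum.inr ⟨u, hu⟩)
        simp only [T, Sum.elim_inl, Sum.elim_inr] at h1 h2
        rw [← hu', ← hw'] at h1 h2
        exact ⟨h1, h2⟩
    intro x x' h
    funext j
    exact le_antisymm (not_lt.1 (key x' x h.symm j)) (not_lt.1 (key x x' h j))
  have hlen : ∀ x y, (T x y).length ≤ κ := by
    intro x y
    rcases y with i | i
    · exact hV (C x) (hmem x) (hyes x) _ _ (hadj i)
    · exact hV (C x) (hmem x) (hyes x) _ _ (hadj i).symm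
  simpa using card_le_of_injective_strings T hlen hT

theorem lt_pow_of_sixteen_pow_lt {k κ : ℕ} (h : 16 ^ κ < k) (hk : 2 ≤ k) :
    (2 ^ (κ + 1) - 1) ^ 10 < (k + 1) ^ 4 := by
  rcases κ with _ | _ | κ
  · calc (2 ^ (0 + 1) - 1) ^ 10 < (2 + 1) ^ 4 := by norm_num
      _ ≤ (k + 1) ^ 4 := by gcongr
  · calc (2 ^ (0 + 1 + 1) - 1) ^ 10 < (17 + 1) ^ 4 := by norm_num
      _ ≤ (k + 1) ^ 4 := by gcongr; omega
  · calc (2 ^ (κ + 1 + 1 + 1) - 1) ^ 10 ≤ (2 ^ (κ + 1 + 1 + 1)) ^ 10 :=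
        Nat.pow_le_pow_left (Nat.sub_le _ _) _
      _ = 2 ^ (10 * κ + 30) := by rw [← pow_mul]; congr 1; ring
      _ ≤ 2 ^ (16 * κ + 32) := Nat.pow_le_pow_right (by norm_num) (by omega)
      _ = (16 ^ (κ + 1 + 1)) ^ 4 := by
        rw [show 16 = 2 ^ 4 by norm_num, ← pow_mul, ← pow_mul]; congr 1; ring
      _ < (k + 1) ^ 4 := by gcongr; omega

/-- There is a constant `c > 0` (and a constant degree bound `D`)
such that for every `n ≥ 2` and every `1 ≤ k ≤ 2^(c·n)`, there are `n`-node
configurations in `F_st` (over a connected graph of maximum degree at most `D`)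
on which every proof-labeling scheme for `(F_st, k-MF)`, even in the unicast
model MCAST(Δ), has verification complexity at least `(1/4)·log₂ k`; hence the
verification complexity of `(F_st, k-MF)` in the unicast model is `Ω(log k)`. -/
theorem kmf_unicast_lower :
    ∃ c : ℝ, 0 < c ∧ ∃ D : ℕ,
      ∀ n k : ℕ, 2 ≤ n → 1 ≤ k → (k : ℝ) ≤ (2 : ℝ) ^ (c * (n : ℝ)) →
        ∃ G : SimpleGraph (Fin n), G.Connected ∧ maxDeg G ≤ D ∧
          ∃ s t : Fin n, s ≠ t ∧
            ∀ (Sch : Scheme (Fin n) (Fin n → ℕ)) (κ : ℕ),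
              IsPLS (Fstk G s t) (kMF G s t k) (maxDeg G) Sch →
              VCBound (Fstk G s t) (kMF G s t k) Sch κ →
              (1 / 4 : ℝ) * Real.logb 2 (k : ℝ) ≤ (κ : ℝ) := by
  refine ⟨1 / 10, by norm_num, 4, fun n k hn hk hkn => ?_⟩
  rcases hk.eq_or_lt with rfl | hk2
  · obtain ⟨m, rfl⟩ : ∃ m, n = m + 1 := ⟨n - 1, by omega⟩
    refine ⟨SimpleGraph.pathGraph (m + 1), SimpleGraph.pathGraph_connected m,
      maxDeg_le_four _ fun u w h => ?_, ⟨0, by omega⟩, ⟨1, by omega⟩, by simp, ?_⟩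
    · have := SimpleGraph.pathGraph_adj.1 h
      omega
    · intro Sch κ _ _
      simp
  · have hn10 : 10 ≤ n := by
      by_contra! hlt
      have h1 : (1 / 10 : ℝ) * n < 1 := by
        have : (n : ℝ) < 10 := by exact_mod_cast hlt
        linarith
      have h2 := Real.rpow_lt_rpow_of_exponent_lt (x := 2) (by norm_num) h1
      rw [Real.rpow_one] at h2
      have h3 : (2 : ℝ) ≤ k := by exact_mod_cast hk2
      linarith
    refine ⟨ladder n, ladder_connected hn10, maxDeg_le_four _ fun u w h => ?_,
      ⟨0, by omega⟩, ⟨9, by omega⟩, by simp, fun Sch κ hP hV => ?_⟩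
    · have h' : LadderAdj u w := h
      unfold LadderAdj at h'
      omega
    · by_contra! hlt
      have hk0 : (0 : ℝ) < k := by exact_mod_cast hk
      have h16 : 16 ^ κ < k := by
        have h1 : ((4 * κ : ℕ) : ℝ) < Real.logb 2 k := by
          push_cast
          linarith
        rw [Real.lt_logb_iff_rpow_lt (by norm_num) hk0, Real.rpow_natCast, pow_mul] at h1
        norm_num at h1
        exact_mod_cast h1
      exact (lt_pow_of_sixteen_pow_lt h16 hk2).not_ge (ladder_count hn10 hP hV)
end
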